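/- Let d, d_z, d_x ∈ ℕ and let Θ ⊂ ℝ^d be a nonempty compact convex set. Let Q : ℝ^d → ℝ^{d_z×d_z} and F : ℝ^d → ℝ^{d_z×d_x} be continuously differentiable mappings such that Q(θ) is a symmetric positive definite matrix for every θ ∈ Θ. Then there exists a constant κ ∈ (0, ∞) such that for all z ∈ ℝ^{d_z}, x ∈ ℝ^{d_x} and θ, θ' ∈ Θ: |log φ_{d_z}(z; F(θ)x, Q(θ)) − log φ_{d_z}(z; F(θ')x, Q(θ'))| ≤ κ · ‖θ − θ'‖ · (1 + ‖z‖² + ‖x‖²). -/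

import Mathlib

open Matrix

/-- The Euclidean norm on `ℝ^n`. -/
noncomputable def euclNorm {n : ℕ} (x : Fin n → ℝ) : ℝ := Real.sqrt (∑ i, (x i) ^ 2)

/-- The density of the `n`-dimensional Gaussian distribution with mean `m` and
(symmetric positive definite) covariance matrix `V`, with respect to Lebesgue measure. -/
noncomputable def gaussDensity {n : ℕ} (m : Fin n → ℝ) (V : Matrix (Fin n) (Fin n) ℝ)
    (x : Fin n → ℝ) : ℝ :=
  ((2 * Real.pi) ^ n * V.det) ^ (-(1 : ℝ) / 2) *
    Real.exp (-((x - m) ⬝ᵥ (V⁻¹ *ᵥ (x - m))) / 2)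

theorem sq_le_euclNorm_sq {n : ℕ} (x : Fin n → ℝ) (i : Fin n) : x i ^ 2 ≤ euclNorm x ^ 2 := by
  rw [euclNorm, Real.sq_sqrt (Finset.sum_nonneg fun _ _ => sq_nonneg _)]
  exact Finset.single_le_sum (f := fun i => x i ^ 2) (fun _ _ => sq_nonneg _) (Finset.mem_univ i)

theorem norm_le_euclNorm {n : ℕ} (x : Fin n → ℝ) : ‖x‖ ≤ euclNorm x := by
  have h0 : 0 ≤ euclNorm x := Real.sqrt_nonneg _
  refine (pi_norm_le_iff_of_nonneg h0).2 fun i => ?_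
  exact abs_le_of_sq_le_sq (sq_le_euclNorm_sq x i) h0

/-- A function that is continuously differentiable at each point of a compact convex set is
Lipschitz continuous on this set. -/
theorem exists_lipschitz_of_contDiffAt {d : ℕ} {Θ : Set (Fin d → ℝ)} (hcp : IsCompact Θ)
    (hcv : Convex ℝ Θ) {f : (Fin d → ℝ) → ℝ} (hf : ∀ θ ∈ Θ, ContDiffAt ℝ 1 f θ) :
    ∃ K : ℝ, 0 ≤ K ∧ ∀ θ ∈ Θ, ∀ θ' ∈ Θ, |f θ - f θ'| ≤ K * euclNorm (θ - θ') := by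
  have hc : ContinuousOn (fderiv ℝ f) Θ := fun θ hθ =>
    ((hf θ hθ).fderiv_right (m := 0) (by norm_num)).continuousAt.continuousWithinAt
  obtain ⟨C, hC⟩ := hcp.exists_bound_of_continuousOn hc
  refine ⟨max C 0, le_max_right _ _, fun θ hθ θ' hθ' => ?_⟩
  have h := hcv.norm_image_sub_le_of_norm_fderiv_le (𝕜 := ℝ) (f := f) (C := max C 0)
    (fun x hx => (hf x hx).differentiableAt (by norm_num))
    (fun x hx => (hC x hx).trans (le_max_left _ _)) hθ' hθ
  exact h.trans (mul_le_mul_of_nonneg_left (norm_le_euclNorm _) (le_max_right _ _))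

theorem contDiffAt_matrix_det {E : Type*} [NormedAddCommGroup E] [NormedSpace ℝ E] {n : ℕ}
    {A : E → Matrix (Fin n) (Fin n) ℝ} {x : E}
    (hA : ∀ i j, ContDiffAt ℝ 1 (fun y => A y i j) x) :
    ContDiffAt ℝ 1 (fun y => (A y).det) x := by
  simp only [det_apply']
  exact ContDiffAt.sum fun σ _ => contDiffAt_const.mul (contDiffAt_prod fun i _ => hA _ _)

theorem contDiffAt_matrix_inv {E : Type*} [NormedAddCommGroup E] [NormedSpace ℝ E] {n : ℕ}
    {A : E → Matrix (Fin n) (Fin n) ℝ} {x : E}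
    (hA : ∀ i j, ContDiffAt ℝ 1 (fun y => A y i j) x) (hx : (A x).det ≠ 0) (i j : Fin n) :
    ContDiffAt ℝ 1 (fun y => (A y)⁻¹ i j) x := by
  simp only [inv_def, Ring.inverse_eq_inv', Matrix.smul_apply, smul_eq_mul, adjugate_apply]
  refine ((contDiffAt_matrix_det hA).inv hx).mul (contDiffAt_matrix_det fun k l => ?_)
  simp only [updateRow_apply]
  split_ifs
  · exact contDiffAt_const
  · exact hA k l

theorem contDiffAt_matrix_mul {E : Type*} [NormedAddCommGroup E] [NormedSpace ℝ E]
    {l m n : Type*} [Fintype m] {A : E → Matrix l m ℝ} {B : E → Matrix m n ℝ} {x : E}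
    (hA : ∀ i j, ContDiffAt ℝ 1 (fun y => A y i j) x)
    (hB : ∀ i j, ContDiffAt ℝ 1 (fun y => B y i j) x) (i : l) (j : n) :
    ContDiffAt ℝ 1 (fun y => (A y * B y) i j) x := by
  simp only [mul_apply]
  exact ContDiffAt.sum fun k _ => (hA i k).mul (hB k j)

theorem log_gaussDensity {n : ℕ} (m x : Fin n → ℝ) {V : Matrix (Fin n) (Fin n) ℝ}
    (hV : V.PosDef) :
    Real.log (gaussDensity m V x) =
      -(n * Real.log (2 * Real.pi) + Real.log V.det) / 2 -
        ((x - m) ⬝ᵥ (V⁻¹ *ᵥ (x - m))) / 2 := by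
  have hd := hV.det_pos
  have hp : 0 < (2 * Real.pi) ^ n := by positivity
  rw [gaussDensity, Real.log_mul (Real.rpow_pos_of_pos (mul_pos hp hd) _).ne'
    (Real.exp_pos _).ne', Real.log_exp, Real.log_rpow (mul_pos hp hd),
    Real.log_mul hp.ne' hd.ne', Real.log_pow]
  ring

theorem abs_quadForm_sub_le {ι : Type*} [Fintype ι] {M N K : Matrix ι ι ℝ} {w : ι → ℝ} {r s : ℝ}
    (hMN : ∀ a b, |M a b - N a b| ≤ K a b * r) (hw : ∀ a, w a ^ 2 ≤ s) :
    |w ⬝ᵥ (M *ᵥ w) - w ⬝ᵥ (N *ᵥ w)| ≤ (∑ a, ∑ b, K a b) * r * s := by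
  have h : w ⬝ᵥ (M *ᵥ w) - w ⬝ᵥ (N *ᵥ w) = ∑ a, ∑ b, (M a b - N a b) * (w a * w b) := by
    rw [← dotProduct_sub, ← sub_mulVec]
    simp only [dotProduct, mulVec, Finset.mul_sum, Matrix.sub_apply]
    exact Finset.sum_congr rfl fun a _ => Finset.sum_congr rfl fun b _ => by ring
  rw [h, Finset.sum_mul, Finset.sum_mul]
  refine (Finset.abs_sum_le_sum_abs _ _).trans (Finset.sum_le_sum fun a _ => ?_)
  rw [Finset.sum_mul, Finset.sum_mul]
  refine (Finset.abs_sum_le_sum_abs _ _).trans (Finset.sum_le_sum fun b _ => ?_)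
  rw [abs_mul]
  have hab : |w a * w b| ≤ s := abs_le.2
    ⟨by nlinarith [hw a, hw b, sq_nonneg (w a + w b)],
      by nlinarith [hw a, hw b, sq_nonneg (w a - w b)]⟩
  exact mul_le_mul (hMN a b) hab (abs_nonneg _) ((abs_nonneg _).trans (hMN a b))

theorem quadForm_sub_mulVec {m n : ℕ} (A : Matrix (Fin m) (Fin m) ℝ)
    (F : Matrix (Fin m) (Fin n) ℝ) (z : Fin m → ℝ) (x : Fin n → ℝ) :
    (z - F *ᵥ x) ⬝ᵥ (A *ᵥ (z - F *ᵥ x)) =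
      Sum.elim z x ⬝ᵥ (((fromCols 1 (-F))ᵀ * (A * fromCols 1 (-F))) *ᵥ Sum.elim z x) := by
  have h : fromCols 1 (-F) *ᵥ Sum.elim z x = z - F *ᵥ x := by
    rw [fromCols_mulVec_sumElim, one_mulVec, neg_mulVec, sub_eq_add_neg]
  rw [← mulVec_mulVec, ← mulVec_mulVec, h, dotProduct_mulVec _ (fromCols _ _)ᵀ,
    vecMul_transpose, h]

theorem stmt2 (d dz dx : ℕ) (Θ : Set (Fin d → ℝ)) (hne : Θ.Nonempty)
    (hcp : IsCompact Θ) (hcv : Convex ℝ Θ)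
    (Q : (Fin d → ℝ) → Matrix (Fin dz) (Fin dz) ℝ)
    (F : (Fin d → ℝ) → Matrix (Fin dz) (Fin dx) ℝ)
    (hQ : ∀ i j, ContDiff ℝ 1 fun θ => Q θ i j)
    (hF : ∀ i j, ContDiff ℝ 1 fun θ => F θ i j)
    (hQpd : ∀ θ ∈ Θ, (Q θ).PosDef) :
    ∃ κ : ℝ, 0 < κ ∧ ∀ (z : Fin dz → ℝ) (x : Fin dx → ℝ), ∀ θ ∈ Θ, ∀ θ' ∈ Θ,
      |Real.log (gaussDensity (F θ *ᵥ x) (Q θ) z) -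
          Real.log (gaussDensity (F θ' *ᵥ x) (Q θ') z)| ≤
        κ * euclNorm (θ - θ') * (1 + euclNorm z ^ 2 + euclNorm x ^ 2) := by
  obtain ⟨L, hL0, hL⟩ := exists_lipschitz_of_contDiffAt hcp hcv
    (f := fun θ => Real.log (Q θ).det) fun θ hθ =>
      (contDiffAt_matrix_det fun i j => (hQ i j).contDiffAt).log (hQpd θ hθ).det_pos.ne'
  let B : (Fin d → ℝ) → Matrix (Fin dz) (Fin dz ⊕ Fin dx) ℝ := fun θ => fromCols 1 (-F θ)
  have hB : ∀ θ i j, ContDiffAt ℝ 1 (fun θ => B θ i j) θ := by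
    rintro θ i (j | j)
    · exact contDiffAt_const
    · exact (hF i j).contDiffAt.neg
  let M : (Fin d → ℝ) → Matrix (Fin dz ⊕ Fin dx) (Fin dz ⊕ Fin dx) ℝ :=
    fun θ => (B θ)ᵀ * ((Q θ)⁻¹ * B θ)
  have hM : ∀ a b, ∃ K : ℝ, 0 ≤ K ∧ ∀ θ ∈ Θ, ∀ θ' ∈ Θ,
      |M θ a b - M θ' a b| ≤ K * euclNorm (θ - θ') := fun a b =>
    exists_lipschitz_of_contDiffAt hcp hcv fun θ hθ =>
      contDiffAt_matrix_mul (A := fun θ => (B θ)ᵀ) (fun i j => hB θ j i)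
        (contDiffAt_matrix_mul
          (contDiffAt_matrix_inv (fun i j => (hQ i j).contDiffAt) (hQpd θ hθ).det_pos.ne')
          (hB θ)) a b
  choose K hK0 hK using hM
  have hS : 0 ≤ ∑ a, ∑ b, K a b := Finset.sum_nonneg fun a _ => Finset.sum_nonneg fun b _ => hK0 a b
  refine ⟨L + (∑ a, ∑ b, K a b) + 1, by positivity, fun z x θ hθ θ' hθ' => ?_⟩
  rw [log_gaussDensity _ _ (hQpd θ hθ), log_gaussDensity _ _ (hQpd θ' hθ'),
    quadForm_sub_mulVec, quadForm_sub_mulVec]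
  have h1 := hL θ hθ θ' hθ'
  have h2 := abs_quadForm_sub_le (M := M θ) (N := M θ') (K := K) (w := Sum.elim z x)
    (r := euclNorm (θ - θ')) (s := euclNorm z ^ 2 + euclNorm x ^ 2)
    (fun a b => hK a b θ hθ θ' hθ') (by
      rintro (a | a)
      · exact (sq_le_euclNorm_sq z a).trans (le_add_of_nonneg_right (sq_nonneg _))
      · exact (sq_le_euclNorm_sq x a).trans (le_add_of_nonneg_left (sq_nonneg _)))
  change |_ - Sum.elim z x ⬝ᵥ (M θ *ᵥ Sum.elim z x) / 2 -
    (_ - Sum.elim z x ⬝ᵥ (M θ' *ᵥ Sum.elim z x) / 2)| ≤ _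
  have hr : 0 ≤ euclNorm (θ - θ') := Real.sqrt_nonneg _
  have hs : 0 ≤ euclNorm z ^ 2 + euclNorm x ^ 2 := by positivity
  generalize euclNorm (θ - θ') = r at *
  rw [add_assoc 1]
  generalize euclNorm z ^ 2 + euclNorm x ^ 2 = s at *
  generalize (∑ a, ∑ b, K a b) = S at *
  have hLrs : 0 ≤ L * r * s := by positivity
  have hSr : 0 ≤ S * r := by positivity
  have hSrs : 0 ≤ S * r * s := by positivity
  have hLr : 0 ≤ L * r := by positivity
  have hrs : 0 ≤ r * s := by positivity
  have hexp : (L + S + 1) * r * (1 + s) = L * r + L * r * s + S * r + S * r * s + r + r * s := by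
    ring
  rw [hexp]
  rw [abs_le] at *
  constructor <;> linarith
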